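/- Let T be a tournament on n vertices, let S be the set of cyclic triangles (3-element vertex subsets inducing a directed 3-cycle) of T, and for an unordered pair e of distinct vertices let S_e = {s ∈ S : e ⊆ s}. Then the number of 4-element vertex subsets of T inducing a subtournament isomorphic to C₄ equals Σ_e binom(|S_e|, 2), the sum ranging over all unordered pairs of distinct vertices. (Two cyclic triangles sharing a common pair of vertices span a C₄, and each C₄ arises exactly once this way.) -/

import Mathlib

open Finset

/-- A tournament: an irreflexive relation such that for distinct vertices exactly one of
`r x y`, `r y x` holds. -/
def IsTournament {V : Type} (r : V → V → Prop) : Prop :=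
  (∀ x, ¬ r x x) ∧ ∀ x y : V, x ≠ y → (r x y ↔ ¬ r y x)

/-- The transitive tournament on 4 vertices. -/
def T4rel : Fin 4 → Fin 4 → Prop := fun i j => i < j

/-- The unique strongly connected tournament on 4 vertices. -/
def C4rel : Fin 4 → Fin 4 → Prop := fun i j =>
  (i = 0 ∧ j = 1) ∨ (i = 1 ∧ j = 2) ∨ (i = 2 ∧ j = 3) ∨ (i = 3 ∧ j = 0) ∨
  (i = 0 ∧ j = 2) ∨ (i = 1 ∧ j = 3)

/-- The 4-vertex tournament in which a cyclic triangle beats a fourth vertex. -/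
def W4rel : Fin 4 → Fin 4 → Prop := fun i j =>
  (i = 0 ∧ j = 1) ∨ (i = 1 ∧ j = 2) ∨ (i = 2 ∧ j = 0) ∨
  (i = 0 ∧ j = 3) ∨ (i = 1 ∧ j = 3) ∨ (i = 2 ∧ j = 3)

/-- The 4-vertex tournament in which one vertex beats a cyclic triangle. -/
def L4rel : Fin 4 → Fin 4 → Prop := fun i j =>
  (i = 0 ∧ j = 1) ∨ (i = 1 ∧ j = 2) ∨ (i = 2 ∧ j = 0) ∨
  (i = 3 ∧ j = 0) ∨ (i = 3 ∧ j = 1) ∨ (i = 3 ∧ j = 2)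

/-- The cyclic triangle (directed 3-cycle). -/
def C3rel : Fin 3 → Fin 3 → Prop := fun i j =>
  (i = 0 ∧ j = 1) ∨ (i = 1 ∧ j = 2) ∨ (i = 2 ∧ j = 0)

/-- `s` induces a subtournament isomorphic to the pattern `m`. -/
def InducesPattern {V : Type} {k : ℕ} (r : V → V → Prop) (m : Fin k → Fin k → Prop)
    (s : Finset V) : Prop :=
  ∃ f : Fin k → V, Function.Injective f ∧ Set.range f = (s : Set V) ∧
    ∀ i j : Fin k, m i j ↔ r (f i) (f j)

-- the number of `k`-element vertex subsets inducing a copy of the pattern `m`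
open Classical in
noncomputable def patternCount {V : Type} [Fintype V] {k : ℕ} (r : V → V → Prop)
    (m : Fin k → Fin k → Prop) : ℕ :=
  (((univ : Finset V).powersetCard k).filter (fun s => InducesPattern r m s)).card

-- the probability that a uniformly random `k`-element vertex subset induces a copy of `m`
noncomputable def patternDensity {V : Type} [Fintype V] {k : ℕ} (r : V → V → Prop)
    (m : Fin k → Fin k → Prop) : ℝ :=
  (patternCount r m : ℝ) / ((Fintype.card V).choose k)

lemma c3_char {V : Type} [DecidableEq V] (r : V → V → Prop) (hT : IsTournament r)
    (s : Finset V) :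
    InducesPattern r C3rel s ↔ ∃ a b c, s = {a, b, c} ∧ r a b ∧ r b c ∧ r c a := by
  obtain ⟨h1, h2⟩ := hT
  constructor
  · rintro ⟨f, hf, hr, hm⟩
    refine ⟨f 0, f 1, f 2, ?_, (hm 0 1).1 (by simp [C3rel]), (hm 1 2).1 (by simp [C3rel]),
      (hm 2 0).1 (by simp [C3rel])⟩
    apply Finset.coe_injective
    rw [← hr]
    ext x
    simp [Fin.exists_fin_succ, eq_comm]
  · rintro ⟨a, b, c, rfl, hab, hbc, hca⟩
    have nab : a ≠ b := fun h => h1 a (by rw [← h] at hab; exact hab)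
    have nbc : b ≠ c := fun h => h1 b (by rw [← h] at hbc; exact hbc)
    have nca : c ≠ a := fun h => h1 c (by rw [← h] at hca; exact hca)
    have hba := (h2 a b nab).1 hab
    have hcb := (h2 b c nbc).1 hbc
    have hac := (h2 c a nca).1 hca
    refine ⟨![a, b, c], ?_, ?_, ?_⟩
    · intro i j hij
      fin_cases i <;> fin_cases j <;> simp_all
    · ext x
      simp [eq_comm]
      tauto
    · intro i j
      fin_cases i <;> fin_cases j <;> simp [C3rel, *]

lemma c4_char {V : Type} [DecidableEq V] (r : V → V → Prop) (hT : IsTournament r)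
    (s : Finset V) :
    InducesPattern r C4rel s ↔ ∃ a b c d, s = {a, b, c, d} ∧ r a b ∧ r b c ∧ r c d ∧ r d a ∧
      r a c ∧ r b d := by
  obtain ⟨h1, h2⟩ := hT
  constructor
  · rintro ⟨f, hf, hr, hm⟩
    refine ⟨f 0, f 1, f 2, f 3, ?_, (hm 0 1).1 (by simp [C4rel]), (hm 1 2).1 (by simp [C4rel]),
      (hm 2 3).1 (by simp [C4rel]), (hm 3 0).1 (by simp [C4rel]), (hm 0 2).1 (by simp [C4rel]),
      (hm 1 3).1 (by simp [C4rel])⟩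
    apply Finset.coe_injective
    rw [← hr]
    ext x
    simp [Fin.exists_fin_succ, eq_comm]
  · rintro ⟨a, b, c, d, rfl, hab, hbc, hcd, hda, hac, hbd⟩
    have ne : ∀ x y, r x y → x ≠ y := fun x y h e => h1 x (by rw [← e] at h; exact h)
    have as : ∀ x y, r x y → ¬ r y x := fun x y h => (h2 x y (ne x y h)).1 h
    have := ne _ _ hab
    have := ne _ _ hbc
    have := ne _ _ hcd
    have := ne _ _ hda
    have := ne _ _ hac
    have := ne _ _ hbd
    have := as _ _ hab
    have := as _ _ hbc
    have := as _ _ hcd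
    have := as _ _ hda
    have := as _ _ hac
    have := as _ _ hbd
    clear ne as h2
    refine ⟨![a, b, c, d], ?_, ?_, ?_⟩
    · intro i j hij
      fin_cases i <;> fin_cases j <;> simp_all
    · ext x
      simp [eq_comm]
      tauto
    · intro i j
      fin_cases i <;> fin_cases j <;> simp [C4rel, *]

/-- A cyclic triangle containing an arc `x → y` is `x → y → z → x`. -/
lemma tri_arc {V : Type} [DecidableEq V] (r : V → V → Prop) (hT : IsTournament r)
    (s : Finset V) (hs : InducesPattern r C3rel s) (x y : V) (hxy : r x y)
    (hx : x ∈ s) (hy : y ∈ s) : ∃ z, s = {x, y, z} ∧ r y z ∧ r z x := by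
  obtain ⟨a, b, c, rfl, hab, hbc, hca⟩ := (c3_char r hT s).1 hs
  obtain ⟨h1, h2⟩ := hT
  have as : ∀ x y, r x y → ¬ r y x := fun x y h h' =>
    (h2 x y (by rintro rfl; exact h1 _ h)).1 h h'
  simp only [mem_insert, mem_singleton] at hx hy
  rcases hx with rfl | rfl | rfl <;> rcases hy with rfl | rfl | rfl
  · exact absurd hxy (h1 _)
  · exact ⟨c, rfl, hbc, hca⟩
  · exact absurd hxy (as _ _ hca)
  · exact absurd hxy (as _ _ hab)
  · exact absurd hxy (h1 _)
  · exact ⟨a, by ext; simp; tauto, hca, hab⟩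
  · exact ⟨b, by ext; simp; tauto, hab, hbc⟩
  · exact absurd hxy (as _ _ hbc)
  · exact absurd hxy (h1 _)

/-- The cyclic triangles inside a `C₄`. -/
lemma tri_in_c4 {V : Type} [DecidableEq V] (r : V → V → Prop) (hT : IsTournament r)
    (a b c d : V) (hab : r a b) (hbc : r b c) (hcd : r c d) (hda : r d a) (hac : r a c)
    (hbd : r b d) (t : Finset V) (ht : InducesPattern r C3rel t) (hsub : t ⊆ {a, b, c, d}) :
    t = {a, b, d} ∨ t = {a, c, d} := by
  obtain ⟨x, y, z, rfl, hxy, hyz, hzx⟩ := (c3_char r hT t).1 ht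
  obtain ⟨h1, h2⟩ := hT
  have as : ∀ x y, r x y → ¬ r y x := fun x y h h' =>
    (h2 x y (by rintro rfl; exact h1 _ h)).1 h h'
  have := as _ _ hab
  have := as _ _ hbc
  have := as _ _ hcd
  have := as _ _ hda
  have := as _ _ hac
  have := as _ _ hbd
  have hx : x ∈ ({a, b, c, d} : Finset V) := hsub (by simp)
  have hy : y ∈ ({a, b, c, d} : Finset V) := hsub (by simp)
  have hz : z ∈ ({a, b, c, d} : Finset V) := hsub (by simp)
  have haa := h1 a
  have hbb := h1 b
  have hcc := h1 c
  have hdd := h1 d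
  clear hsub ht as h2 h1
  simp only [mem_insert, mem_singleton] at hx hy hz
  rcases hx with rfl | rfl | rfl | rfl <;> rcases hy with rfl | rfl | rfl | rfl <;>
    first
    | contradiction
    | (rcases hz with rfl | rfl | rfl | rfl <;>
        first
        | contradiction
        | (left; ext; simp <;> tauto)
        | (right; ext; simp <;> tauto))

/-- Two cyclic triangles sharing a pair span a `C₄`. -/
lemma union_c4 {V : Type} [DecidableEq V] (r : V → V → Prop) (hT : IsTournament r)
    (e t u : Finset V) (he : e.card = 2) (ht : InducesPattern r C3rel t)
    (hu : InducesPattern r C3rel u) (het : e ⊆ t) (heu : e ⊆ u) (htu : t ≠ u) :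
    InducesPattern r C4rel (t ∪ u) := by
  obtain ⟨x, y, hxy, rfl⟩ := Finset.card_eq_two.1 he
  wlog h : r x y generalizing x y
  · refine this y x hxy.symm (by rwa [pair_comm]) (by rwa [pair_comm]) (by rwa [pair_comm]) ?_
    by_contra h'
    exact h ((hT.2 x y hxy).2 h')
  obtain ⟨z, rfl, hyz, hzx⟩ := tri_arc r hT t ht x y h (het (by simp)) (het (by simp))
  obtain ⟨w, rfl, hyw, hwx⟩ := tri_arc r hT u hu x y h (heu (by simp)) (heu (by simp))
  have hzw : z ≠ w := by rintro rfl; exact htu rfl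
  rw [c4_char r hT]
  by_cases h' : r z w
  · exact ⟨y, z, w, x, by ext; simp; tauto, hyz, h', hwx, h, hyw, hzx⟩
  · have h'' : r w z := (hT.2 w z hzw.symm).2 h'
    exact ⟨y, w, z, x, by ext; simp; tauto, hyw, h'', hzx, h, hyz, hwx⟩

lemma c4_card {V : Type} {r : V → V → Prop} {k : ℕ} {m : Fin k → Fin k → Prop} {s : Finset V}
    (h : InducesPattern r m s) : s.card = k := by
  obtain ⟨f, hf, hr, -⟩ := h
  rw [← Set.ncard_coe_finset, ← hr, Set.ncard_range_of_injective hf, Nat.card_fin]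

/-- The pair and the two triangles are determined by the `C₄`. -/
lemma pair_in_c4 {V : Type} [DecidableEq V] (r : V → V → Prop) (hT : IsTournament r)
    (a b c d : V) (hab : r a b) (hbc : r b c) (hcd : r c d) (hda : r d a) (hac : r a c)
    (hbd : r b d) (e t u : Finset V) (he : e.card = 2) (ht : InducesPattern r C3rel t)
    (hu : InducesPattern r C3rel u) (het : e ⊆ t) (heu : e ⊆ u) (htu : t ≠ u)
    (h : t ∪ u = {a, b, c, d}) :
    e = {a, d} ∧ ({t, u} : Finset (Finset V)) = {{a, b, d}, {a, c, d}} := by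
  have h1 := tri_in_c4 r hT a b c d hab hbc hcd hda hac hbd t ht (h ▸ subset_union_left)
  have h2 := tri_in_c4 r hT a b c d hab hbc hcd hda hac hbd u hu (h ▸ subset_union_right)
  have hbc' : b ≠ c := by rintro rfl; exact hT.1 _ hbc
  have had : a ≠ d := by rintro rfl; exact hT.1 _ hda
  have key : e ⊆ {a, b, d} → e ⊆ {a, c, d} → e = {a, d} := by
    intro k1 k2
    apply Finset.eq_of_subset_of_card_le
    · intro x hx
      have := k1 hx
      have := k2 hx
      simp only [mem_insert, mem_singleton] at *
      grind
    · rw [he, card_pair had]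
  rcases h1 with rfl | rfl <;> rcases h2 with rfl | rfl
  · exact absurd rfl htu
  · exact ⟨key het heu, rfl⟩
  · exact ⟨key heu het, pair_comm _ _⟩
  · exact absurd rfl htu

open Classical in
theorem c4_count_eq_sum_over_pairs {V : Type} [Fintype V] (r : V → V → Prop)
    (hT : IsTournament r) :
    patternCount r C4rel =
      ∑ e ∈ (univ : Finset V).powersetCard 2,
        Nat.choose (((univ : Finset V).powersetCard 3).filter
          (fun s => InducesPattern r C3rel s ∧ e ⊆ s)).card 2 := by
  simp_rw [← Finset.card_powersetCard 2]
  rw [← Finset.card_sigma, patternCount]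
  symm
  have mem : ∀ p : (_ : Finset V) × Finset (Finset V),
      p ∈ ((univ : Finset V).powersetCard 2).sigma (fun e => powersetCard 2
        (((univ : Finset V).powersetCard 3).filter
          (fun s => InducesPattern r C3rel s ∧ e ⊆ s))) ↔
      p.1.card = 2 ∧ ∃ t u, t ≠ u ∧ p.2 = {t, u} ∧ InducesPattern r C3rel t ∧
        InducesPattern r C3rel u ∧ p.1 ⊆ t ∧ p.1 ⊆ u := by
    rintro ⟨e, P⟩
    simp only [mem_sigma, mem_powersetCard, subset_univ, true_and]
    refine and_congr_right fun he => ?_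
    constructor
    · rintro ⟨hP, hc⟩
      obtain ⟨t, u, htu, rfl⟩ := Finset.card_eq_two.1 hc
      have h1 := hP (mem_insert_self t {u})
      have h2 := hP (mem_insert_of_mem (mem_singleton_self u))
      simp only [mem_filter] at h1 h2
      exact ⟨t, u, htu, rfl, h1.2.1, h2.2.1, h1.2.2, h2.2.2⟩
    · rintro ⟨t, u, htu, rfl, ht, hu, het, heu⟩
      refine ⟨?_, card_pair htu⟩
      intro x hx
      simp only [mem_insert, mem_singleton] at hx
      rcases hx with rfl | rfl
      · simp [ht, het, c4_card ht]
      · simp [hu, heu, c4_card hu]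
  refine Finset.card_bij (fun p _ => p.2.sup id) ?_ ?_ ?_
  · intro p hp
    obtain ⟨he, t, u, htu, hP, ht, hu, het, heu⟩ := (mem p).1 hp
    have := union_c4 r hT p.1 t u he ht hu het heu htu
    simp [hP, this, c4_card this]
  · rintro ⟨e, P⟩ hp ⟨e', P'⟩ hq heq
    obtain ⟨he, t, u, htu, hP, ht, hu, het, heu⟩ := (mem _).1 hp
    obtain ⟨he', t', u', htu', hP', ht', hu', het', heu'⟩ := (mem _).1 hq
    simp only at *
    subst hP hP'
    have h4 := union_c4 r hT e t u he ht hu het heu htu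
    obtain ⟨a, b, c, d, hs, hab, hbc, hcd, hda, hac, hbd⟩ := (c4_char r hT _).1 h4
    have hs' : t' ∪ u' = {a, b, c, d} := by
      rw [← hs]
      simpa using heq.symm
    obtain ⟨q1, q2⟩ := pair_in_c4 r hT a b c d hab hbc hcd hda hac hbd e t u he ht hu het heu
      htu hs
    obtain ⟨q3, q4⟩ := pair_in_c4 r hT a b c d hab hbc hcd hda hac hbd e' t' u' he' ht' hu'
      het' heu' htu' hs'
    rw [q1, q2, q3, q4]
  · intro s hs
    obtain ⟨a, b, c, d, rfl, hab, hbc, hcd, hda, hac, hbd⟩ :=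
      (c4_char r hT _).1 (mem_filter.1 hs).2
    have ne : ∀ x y, r x y → x ≠ y := fun x y h e => hT.1 x (by rw [← e] at h; exact h)
    have n1 := ne _ _ hab
    have n2 := ne _ _ hbc
    have n3 := ne _ _ hbd
    refine ⟨⟨{a, d}, {{a, b, d}, {a, c, d}}⟩, (mem _).2 ⟨card_pair (ne _ _ hda).symm,
      _, _, ?_, rfl, (c3_char r hT _).2 ⟨a, b, d, rfl, hab, hbd, hda⟩,
      (c3_char r hT _).2 ⟨a, c, d, rfl, hac, hcd, hda⟩, ?_, ?_⟩, ?_⟩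
    · intro h
      have : b ∈ ({a, c, d} : Finset V) := h ▸ (by simp)
      simp only [mem_insert, mem_singleton] at this
      tauto
    · intro x; simp; tauto
    · intro x; simp; tauto
    · ext x; simp; tauto
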